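/- arXiv:1409.7595 — 10 statements merged into one kernel-verified Lean document; each statement's English description precedes it below -/
import Mathlib

section
/- Fix a natural number n ≥ 1 and real numbers B > 0 and f > 0. Suppose that for every k ∈ {1, …, n} there are real numbers P_k and q_k with q_k ≥ 0 such that: (i) f · q_k ≥ k for all k ∈ {1,…,n}; (ii) P_1 − B · q_1 ≥ 0; (iii) P_k − (B/k) · q_k ≥ P_{k−1} − (B/k) · q_{k−1} for all k with 2 ≤ k ≤ n; and (iv) P_n ≤ B. Then f ≥ ∑_{k=1}^n 1/k, and in particular f ≥ ln n. -/
/-- Analytic core of the `ln n` lower bound for bounded knapsack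
(Theorem 3.2): for a single seller with `n` units, if `q k` and `P k` are
the expected allocation and payment at bid `B/k`, then the approximation
guarantee, individual rationality, truthfulness and budget feasibility
force `f ≥ ∑_{k=1}^n 1/k ≥ ln n`. -/
theorem stmt_0 (n : ℕ) (hn : 1 ≤ n) (B f : ℝ) (hB : 0 < B) (hf : 0 < f)
    (P q : ℕ → ℝ)
    (hq : ∀ k ∈ Finset.Icc 1 n, 0 ≤ q k)
    (happrox : ∀ k ∈ Finset.Icc 1 n, f * q k ≥ (k : ℝ))
    (hIR : P 1 - B * q 1 ≥ 0)
    (htruth : ∀ k, 2 ≤ k → k ≤ n →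
      P k - (B / k) * q k ≥ P (k - 1) - (B / k) * q (k - 1))
    (hbudget : P n ≤ B) :
    f ≥ ∑ k ∈ Finset.Icc 1 n, (1 : ℝ) / k ∧ f ≥ Real.log n := by
  have key : ∀ m : ℕ, 1 ≤ m → m ≤ n →
      f * P m ≥ B * (∑ k ∈ Finset.Icc 1 m, (1 : ℝ) / k) + (B / m) * (f * q m - m) := by
    intro m hm
    induction m, hm using Nat.le_induction with
    | base =>
      intro _
      have := mul_nonneg hf.le hIR
      simp
      nlinarith
    | succ m hm ih =>
      intro hmn
      have h1 := ih (by omega)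
      have ha := happrox m (Finset.mem_Icc.2 ⟨hm, by omega⟩)
      have ht := htruth (m + 1) (by omega) hmn
      rw [Nat.add_sub_cancel] at ht
      rw [Finset.sum_Icc_succ_top (by omega)]
      generalize (∑ k ∈ Finset.Icc 1 m, (1 : ℝ) / k) = H at *
      have hm0 : (0 : ℝ) < m := by exact_mod_cast hm
      push_cast at *
      have h2 := mul_le_mul_of_nonneg_left ht hf.le
      have h3 : 0 ≤ (B / m - B / (m + 1)) * (f * q m - m) := by
        apply mul_nonneg
        · rw [sub_nonneg]
          gcongr
          linarith
        · linarith
      have h4 : B / (m + 1) * ((m : ℝ) + 1) = B := by field_simp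
      have h5 : B / m * (m : ℝ) = B := by field_simp
      have h6 : B * (1 / ((m : ℝ) + 1)) = B / (m + 1) := by ring
      rw [ge_iff_le, mul_add, h6]
      linear_combination h1 + h2 + h3 + 0 * h4
  have hk := key n hn le_rfl
  have ha := happrox n (Finset.mem_Icc.2 ⟨hn, le_rfl⟩)
  have h3 : 0 ≤ (B / n) * (f * q n - n) := mul_nonneg (by positivity) (by linarith)
  have h4 := mul_le_mul_of_nonneg_left hbudget hf.le
  have main : f ≥ ∑ k ∈ Finset.Icc 1 n, (1 : ℝ) / k := by
    refine le_of_mul_le_mul_left ?_ hB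
    linarith
  refine ⟨main, le_trans ?_ main⟩
  have h := log_le_harmonic_floor (n : ℝ) (by positivity)
  rw [Nat.floor_natCast, harmonic_eq_sum_Icc] at h
  push_cast at h
  simpa using h
end

section
/- Fix a natural number n ≥ 1 and a real number B > 0. Suppose that for every k ∈ {1, …, n} there are real numbers P_k and q_k such that P_1 − B · q_1 ≥ 0 and P_k − (B/k) · q_k ≥ P_{k−1} − (B/k) · q_{k−1} for all k with 2 ≤ k ≤ n. Then P_n ≥ (B/n) · q_n + ∑_{k=1}^{n−1} (B/(k(k+1))) · q_k. -/
/-- Telescoping step in the proof of Theorem 3.2: individual rationality at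
cost `B` and truthfulness between the bids `B/(k-1)` and `B/k` imply the
lower bound `P n ≥ (B/n) q n + ∑_{k=1}^{n-1} (B/(k(k+1))) q k` on the
payment at bid `B/n`. -/
theorem stmt_1 (n : ℕ) (hn : 1 ≤ n) (B : ℝ) (hB : 0 < B)
    (P q : ℕ → ℝ)
    (hIR : P 1 - B * q 1 ≥ 0)
    (htruth : ∀ k, 2 ≤ k → k ≤ n →
      P k - (B / k) * q k ≥ P (k - 1) - (B / k) * q (k - 1)) :
    P n ≥ (B / n) * q n +
      ∑ k ∈ Finset.Icc 1 (n - 1), (B / (k * (k + 1))) * q k := by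
  induction n, hn using Nat.le_induction with
  | base => simp; linarith
  | succ m hm ih =>
    have ih' := ih (fun k h1 h2 => htruth k h1 (by omega))
    have h := htruth (m + 1) (by omega) le_rfl
    obtain ⟨j, rfl⟩ : ∃ j, m = j + 1 := ⟨m - 1, by omega⟩
    simp only [Nat.add_sub_cancel] at h ih' ⊢
    rw [Finset.sum_Icc_succ_top (by omega)]
    have e : B / ((j + 1 : ℕ) : ℝ) * q (j + 1) = B / ((j + 1 + 1 : ℕ) : ℝ) * q (j + 1)
        + B / (((j + 1 : ℕ) : ℝ) * (((j + 1 : ℕ) : ℝ) + 1)) * q (j + 1) := by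
      push_cast
      have h1 : (j : ℝ) + 1 ≠ 0 := by positivity
      have h2 : (j : ℝ) + 1 + 1 ≠ 0 := by positivity
      field_simp
    linarith
end

section
/- Let n ≥ 2 be a natural number and B > 0, f > 0 real numbers. Suppose a : ℝ → ℕ and P : ℝ → ℝ satisfy, for all c, b ∈ (0, B]: (truthfulness) P(b) − c·a(b) ≤ P(c) − c·a(c); (individual rationality) P(c) ≥ c·a(c); (budget feasibility) P(c) ≤ B; and (f-approximation) f · a(c) ≥ min(n, ⌊B/c⌋). Then f ≥ n. -/
/-- Observation 3.1: no deterministic DST, individually rational,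
budget-feasible mechanism for a single seller with `n` units can be better
than an `n`-approximation. Here `a b` is the number of units bought and
`P b` the payment at bid `b ∈ (0, B]`. -/
theorem stmt_2 (n : ℕ) (hn : 2 ≤ n) (B f : ℝ) (hB : 0 < B) (hf : 0 < f)
    (a : ℝ → ℕ) (P : ℝ → ℝ)
    (htruth : ∀ c ∈ Set.Ioc (0 : ℝ) B, ∀ b ∈ Set.Ioc (0 : ℝ) B,
      P b - c * a b ≤ P c - c * a c)
    (hIR : ∀ c ∈ Set.Ioc (0 : ℝ) B, P c ≥ c * a c)
    (hbudget : ∀ c ∈ Set.Ioc (0 : ℝ) B, P c ≤ B)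
    (happrox : ∀ c ∈ Set.Ioc (0 : ℝ) B,
      f * a c ≥ (min (n : ℤ) ⌊B / c⌋ : ℝ)) :
    f ≥ n := by
  have hBm : B ∈ Set.Ioc (0 : ℝ) B := ⟨hB, le_refl B⟩
  have hn' : (2 : ℝ) ≤ n := by exact_mod_cast hn
  have hn0 : (0 : ℝ) < n := by linarith
  have h1 := happrox B hBm
  have haB : 1 ≤ a B := by
    by_contra h
    have h0 : a B = 0 := by omega
    rw [h0, div_self hB.ne'] at h1
    simp only [Int.floor_one, Int.cast_natCast, Int.cast_one, Nat.cast_zero, mul_zero] at h1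
    rw [min_eq_right (by linarith)] at h1
    linarith
  have haB' : (1 : ℝ) ≤ a B := by exact_mod_cast haB
  have hPB : B ≤ P B := by
    have := hIR B hBm
    nlinarith
  have haB1 : (a B : ℝ) ≤ 1 := by
    have h2 := hIR B hBm
    have h3 := hbudget B hBm
    by_contra h
    push Not at h
    nlinarith
  have hc : B / n ∈ Set.Ioc (0 : ℝ) B :=
    ⟨by positivity, div_le_self hB.le (by linarith)⟩
  have ht := htruth _ hc B hBm
  have hb := hbudget _ hc
  have hac : (a (B / n) : ℝ) ≤ 1 := by
    by_contra h
    push Not at h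
    nlinarith [hc.1]
  have h4 := happrox _ hc
  have h5 : B / (B / (n : ℝ)) = n := by field_simp
  rw [h5] at h4
  simp at h4
  nlinarith
end

section
/- Let N ≥ 1 be a natural number, B > 0 a real, and v, c : Fin N → ℝ with v(ℓ) > 0 and c(ℓ) > 0 for all ℓ, such that ℓ ↦ c(ℓ)/v(ℓ) is monotone nondecreasing. If an index k ∈ Fin N satisfies c(k) · ∑_{ℓ ≤ k} v(ℓ) ≤ B · v(k), then ∑_{ℓ ≤ k} c(ℓ) ≤ B. -/
/-- Budget-feasibility claim for the greedy allocation (proof of Lemma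
A.4): if the ratios `c ℓ / v ℓ` are nondecreasing and index `k` satisfies
the greedy condition `c k / v k ≤ B / ∑_{ℓ ≤ k} v ℓ`, then the total cost
of the prefix up to `k` is at most `B`. -/
theorem stmt_4 (N : ℕ) (hN : 1 ≤ N) (B : ℝ) (hB : 0 < B)
    (v c : Fin N → ℝ) (hv : ∀ ℓ, 0 < v ℓ) (hc : ∀ ℓ, 0 < c ℓ)
    (hmono : Monotone (fun ℓ => c ℓ / v ℓ))
    (k : Fin N) (hk : c k * ∑ ℓ ∈ Finset.Iic k, v ℓ ≤ B * v k) :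
    ∑ ℓ ∈ Finset.Iic k, c ℓ ≤ B := by
  have h : (∑ ℓ ∈ Finset.Iic k, c ℓ) * v k ≤ B * v k := by
    refine le_trans ?_ hk
    rw [Finset.sum_mul, Finset.mul_sum]
    refine Finset.sum_le_sum fun ℓ hℓ => ?_
    have h1 : c ℓ / v ℓ ≤ c k / v k := hmono (Finset.mem_Iic.mp hℓ)
    exact (div_le_div_iff₀ (hv ℓ) (hv k)).mp h1
  exact le_of_mul_le_mul_right h (hv k)
end

section
/- Let N ≥ 1 be a natural number, B > 0 a real, and v, c : Fin N → ℝ with v(ℓ) > 0 and c(ℓ) > 0 for all ℓ, such that ℓ ↦ v(ℓ)/c(ℓ) is monotone nonincreasing. Let k̂ be the largest number in {0, 1, …, N} with ∑_{ℓ < k̂} c(ℓ) ≤ B. Then for every subset S ⊆ Fin N with ∑_{ℓ ∈ S} c(ℓ) ≤ B, one has ∑_{ℓ ∈ S} v(ℓ) ≤ ∑_{ℓ < k̂} v(ℓ) + v(k̂) when k̂ < N, and ∑_{ℓ ∈ S} v(ℓ) ≤ ∑_{ℓ < N} v(ℓ) when k̂ = N. -/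
/-- Inequality (6) in the proof of Lemma A.4: for 0-1 knapsack with items
sorted by value-rate `v/c` decreasingly, the greedy prefix of length `khat`
(the largest `khat ∈ {0,…,N}` whose total cost fits in `B`), together with
the next item when `khat < N`, dominates every budget-feasible set. -/
theorem stmt_5 (N : ℕ) (hN : 1 ≤ N) (B : ℝ) (hB : 0 < B)
    (v c : Fin N → ℝ) (hv : ∀ ℓ, 0 < v ℓ) (hc : ∀ ℓ, 0 < c ℓ)
    (hmono : Antitone (fun ℓ => v ℓ / c ℓ))
    (khat : ℕ) (hkN : khat ≤ N)
    (hfit : ∑ ℓ ∈ Finset.univ.filter (fun ℓ : Fin N => (ℓ : ℕ) < khat), c ℓ ≤ B)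
    (hmax : ∀ j ≤ N,
      (∑ ℓ ∈ Finset.univ.filter (fun ℓ : Fin N => (ℓ : ℕ) < j), c ℓ ≤ B) → j ≤ khat)
    (S : Finset (Fin N)) (hS : ∑ ℓ ∈ S, c ℓ ≤ B) :
    (∀ h : khat < N,
      ∑ ℓ ∈ S, v ℓ ≤
        (∑ ℓ ∈ Finset.univ.filter (fun ℓ : Fin N => (ℓ : ℕ) < khat), v ℓ) + v ⟨khat, h⟩) ∧
    (khat = N → ∑ ℓ ∈ S, v ℓ ≤ ∑ ℓ, v ℓ) := by
  refine ⟨fun h => ?_, fun _ => Finset.sum_le_sum_of_subset_of_nonneg (Finset.subset_univ S)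
    (fun i _ _ => (hv i).le)⟩
  set P := Finset.univ.filter (fun ℓ : Fin N => (ℓ : ℕ) < khat) with hP
  set k : Fin N := ⟨khat, h⟩ with hk
  set r := v k / c k with hr
  have hr0 : 0 < r := div_pos (hv k) (hc k)
  have hrk : r * c k = v k := div_mul_cancel₀ _ (hc k).ne'
  have hbig : B < ∑ ℓ ∈ P, c ℓ + c k := by
    by_contra hcon
    push Not at hcon
    have hins : Finset.univ.filter (fun ℓ : Fin N => (ℓ : ℕ) < khat + 1) = insert k P := by
      ext x
      simp only [hP, hk, Finset.mem_filter, Finset.mem_univ, true_and, Finset.mem_insert,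
        Fin.ext_iff]
      omega
    have hnot : k ∉ P := by simp [hP, hk]
    have := hmax (khat + 1) h (by rw [hins, Finset.sum_insert hnot]; linarith)
    omega
  have key : ∑ ℓ ∈ S, (v ℓ - r * c ℓ) ≤ ∑ ℓ ∈ P, (v ℓ - r * c ℓ) := by
    have e : ∀ T : Finset (Fin N), ∑ ℓ ∈ T, (v ℓ - r * c ℓ)
        = ∑ ℓ, if ℓ ∈ T then (v ℓ - r * c ℓ) else 0 := fun T => by simp
    rw [e S, e P]
    refine Finset.sum_le_sum fun i _ => ?_
    by_cases hi : i ∈ P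
    · have hlt : (i : ℕ) < khat := by simpa [hP] using hi
      have h1 : r ≤ v i / c i := hmono (show i ≤ k from hlt.le)
      rw [le_div_iff₀ (hc i)] at h1
      rw [if_pos hi]
      split_ifs <;> linarith
    · have hge : khat ≤ (i : ℕ) := by simpa [hP] using hi
      have h1 : v i / c i ≤ r := hmono (show k ≤ i from hge)
      rw [div_le_iff₀ (hc i)] at h1
      rw [if_neg hi]
      split_ifs <;> linarith
  simp only [Finset.sum_sub_distrib, ← Finset.mul_sum] at key
  have h2 : r * ∑ ℓ ∈ S, c ℓ ≤ r * (∑ ℓ ∈ P, c ℓ + c k) :=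
    mul_le_mul_of_nonneg_left (by linarith) hr0.le
  rw [mul_add, hrk] at h2
  linarith
end

section
/- Let N ≥ 1 be a natural number, B > 0 a real, and v, c : Fin N → ℝ with v(ℓ) > 0 and c(ℓ) > 0 for all ℓ, such that ℓ ↦ v(ℓ)/c(ℓ) is monotone nonincreasing. Let K := {ℓ ∈ Fin N : c(ℓ) · ∑_{s ≤ ℓ} v(s) ≤ B · v(ℓ)}. Then for every subset S ⊆ Fin N with ∑_{ℓ ∈ S} c(ℓ) ≤ B, one has ∑_{ℓ ∈ S} v(ℓ) ≤ 2 · ∑_{ℓ ∈ K} v(ℓ) + 2 · max_{ℓ ∈ Fin N} v(ℓ). -/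
/-- Approximation guarantee of Lemma A.4 at the level of the 0-1 knapsack
reduction: with items sorted by value-rate `v/c` decreasingly, twice the
value of the greedy set `K = {ℓ : c ℓ * ∑_{s ≤ ℓ} v s ≤ B * v ℓ}` plus
twice the largest single-item value dominates the value of any
budget-feasible set. -/
theorem stmt_6 (N : ℕ) (hN : 1 ≤ N) (B : ℝ) (hB : 0 < B)
    (v c : Fin N → ℝ) (hv : ∀ ℓ, 0 < v ℓ) (hc : ∀ ℓ, 0 < c ℓ)
    (hmono : Antitone (fun ℓ => v ℓ / c ℓ))
    (K : Finset (Fin N))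
    (hK : K = Finset.univ.filter
      (fun ℓ : Fin N => c ℓ * ∑ s ∈ Finset.Iic ℓ, v s ≤ B * v ℓ))
    (S : Finset (Fin N)) (hS : ∑ ℓ ∈ S, c ℓ ≤ B) :
    ∑ ℓ ∈ S, v ℓ ≤ 2 * ∑ ℓ ∈ K, v ℓ +
      2 * Finset.univ.sup' (Finset.univ_nonempty_iff.mpr
        ⟨⟨0, hN⟩⟩ : (Finset.univ : Finset (Fin N)).Nonempty) v := by
  set M := Finset.univ.sup' (Finset.univ_nonempty_iff.mpr
        ⟨⟨0, hN⟩⟩ : (Finset.univ : Finset (Fin N)).Nonempty) v with hM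
  have hvM : ∀ ℓ, v ℓ ≤ M := fun ℓ => Finset.le_sup' v (Finset.mem_univ ℓ)
  have hMpos : 0 < M := lt_of_lt_of_le (hv ⟨0, hN⟩) (hvM _)
  have hKnn : 0 ≤ ∑ ℓ ∈ K, v ℓ := Finset.sum_nonneg fun i _ => (hv i).le
  by_cases hne : (Finset.univ \ K).Nonempty
  · obtain ⟨k, hk, hmin⟩ := Finset.exists_min_image (Finset.univ \ K) id hne
    have hkK : k ∉ K := (Finset.mem_sdiff.mp hk).2
    have hsub : Finset.Iio k ⊆ K := by
      intro j hj
      by_contra hjK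
      have h1 : k ≤ j := hmin j (Finset.mem_sdiff.mpr ⟨Finset.mem_univ _, hjK⟩)
      exact absurd (Finset.mem_Iio.mp hj) (not_lt.mpr h1)
    have hlt : B * v k < c k * ∑ s ∈ Finset.Iic k, v s := by
      rw [hK] at hkK
      simpa using hkK
    have hIio : ∑ s ∈ Finset.Iio k, v s ≤ ∑ ℓ ∈ K, v ℓ :=
      Finset.sum_le_sum_of_subset_of_nonneg hsub fun i _ _ => (hv i).le
    have hIic : ∑ s ∈ Finset.Iic k, v s = v k + ∑ s ∈ Finset.Iio k, v s := by
      rw [← Finset.Iio_insert, Finset.sum_insert (by simp)]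
    have hsplit := Finset.sum_filter_add_sum_filter_not S (fun i => i < k) v
    have h1 : ∑ i ∈ S.filter (fun i => i < k), v i ≤ ∑ s ∈ Finset.Iio k, v s := by
      apply Finset.sum_le_sum_of_subset_of_nonneg
      · intro i hi
        exact Finset.mem_Iio.mpr (Finset.mem_filter.mp hi).2
      · exact fun i _ _ => (hv i).le
    have h2 : (∑ i ∈ S.filter (fun i => ¬ i < k), v i) * c k ≤ v k * B := by
      calc (∑ i ∈ S.filter (fun i => ¬ i < k), v i) * c k
          = ∑ i ∈ S.filter (fun i => ¬ i < k), v i * c k := Finset.sum_mul _ _ _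
        _ ≤ ∑ i ∈ S.filter (fun i => ¬ i < k), v k * c i := by
            apply Finset.sum_le_sum
            intro i hi
            have hki : k ≤ i := not_lt.mp (Finset.mem_filter.mp hi).2
            exact (div_le_div_iff₀ (hc i) (hc k)).mp (hmono hki)
        _ ≤ ∑ i ∈ S, v k * c i :=
            Finset.sum_le_sum_of_subset_of_nonneg (Finset.filter_subset _ _)
              fun i _ _ => (mul_pos (hv k) (hc i)).le
        _ = v k * ∑ i ∈ S, c i := (Finset.mul_sum _ _ _).symm
        _ ≤ v k * B := mul_le_mul_of_nonneg_left hS (hv k).le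
    have h3 : ∑ i ∈ S.filter (fun i => ¬ i < k), v i < ∑ s ∈ Finset.Iic k, v s := by
      apply lt_of_mul_lt_mul_right _ (hc k).le
      linarith
    have := hvM k
    linarith
  · have hall : S ⊆ K := by
      intro j _
      by_contra hjK
      exact hne ⟨j, Finset.mem_sdiff.mpr ⟨Finset.mem_univ _, hjK⟩⟩
    have := Finset.sum_le_sum_of_subset_of_nonneg hall (f := v) fun i _ _ => (hv i).le
    linarith
end

section
/- Let m ≥ 1 be a natural number and V : (Fin m → ℕ) → ℝ a function that is monotone with respect to the pointwise order (A ≤ A' pointwise implies V(A) ≤ V(A')), satisfies V(0) = 0, and is sub-additive: V(A ⊔ A') ≤ V(A) + V(A') for all A, A', where (A ⊔ A')(i) = max(A(i), A'(i)). Let c : Fin m → ℝ with c(i) > 0 for all i, n : Fin m → ℕ, and B > 0. For each i let E_i : Fin m → ℕ be the allocation with E_i(i) = min(n(i), ⌊B/c(i)⌋) and E_i(j) = 0 for j ≠ i. Then every allocation A : Fin m → ℕ with A(i) ≤ n(i) for all i and ∑_i A(i)·c(i) ≤ B satisfies V(A) ≤ m · max_{i ∈ Fin m} V(E_i). -/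
/-- Claim in the proof of Lemma B.1: for a monotone, sub-additive valuation
`V` with `V 0 = 0`, every budget-feasible allocation has value at most
`m` times the best single-item budget-feasible value `max_i V(E_i)`, where
`E_i` takes `min (n i) ⌊B / c i⌋` units of item `i` and nothing else. -/
theorem stmt_8 (m : ℕ) (hm : 1 ≤ m) (V : (Fin m → ℕ) → ℝ)
    (hmono : ∀ A A' : Fin m → ℕ, (∀ i, A i ≤ A' i) → V A ≤ V A')
    (hzero : V (fun _ => 0) = 0)
    (hsub : ∀ A A' : Fin m → ℕ,
      V (fun i => max (A i) (A' i)) ≤ V A + V A')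
    (c : Fin m → ℝ) (hc : ∀ i, 0 < c i) (n : Fin m → ℕ) (B : ℝ) (hB : 0 < B)
    (E : Fin m → Fin m → ℕ)
    (hE : ∀ i j, E i j = if j = i then min (n i) ⌊B / c i⌋₊ else 0)
    (A : Fin m → ℕ) (hAn : ∀ i, A i ≤ n i)
    (hAB : ∑ i, (A i : ℝ) * c i ≤ B) :
    V A ≤ m * Finset.univ.sup' (Finset.univ_nonempty_iff.mpr
      ⟨⟨0, hm⟩⟩ : (Finset.univ : Finset (Fin m)).Nonempty)
      (fun i => V (E i)) := by
  have key : ∀ s : Finset (Fin m),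
      V (fun i => if i ∈ s then A i else 0) ≤ ∑ i ∈ s, V (E i) := by
    intro s
    induction s using Finset.induction_on with
    | empty => simp [hzero]
    | insert a s ha ih =>
      rw [Finset.sum_insert ha]
      refine le_trans (hmono _ _ ?_) (le_trans (hsub (E a) _) (add_le_add le_rfl ih))
      intro i
      by_cases hi : i = a
      · subst hi
        have h1 : A i ≤ ⌊B / c i⌋₊ := by
          apply Nat.le_floor
          rw [le_div_iff₀ (hc i)]
          refine le_trans ?_ hAB
          exact Finset.single_le_sum (f := fun i => (A i : ℝ) * c i)
            (fun j _ => mul_nonneg (Nat.cast_nonneg _) (hc j).le) (Finset.mem_univ i)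
        have h2 := hAn i
        simp [hE, ha, h1, h2]
      · simp [hi]
  have h := key Finset.univ
  simp only [Finset.mem_univ, if_true] at h
  refine h.trans ?_
  have h3 := Finset.sum_le_card_nsmul Finset.univ (fun i => V (E i))
    (Finset.univ.sup' (Finset.univ_nonempty_iff.mpr ⟨⟨0, hm⟩⟩) (fun i => V (E i)))
    (fun i hi => Finset.le_sup' (fun i => V (E i)) hi)
  simpa using h3
end

section
/- Let m ≥ 1 be a natural number and V : (Fin m → ℕ) → ℝ a function that is monotone with respect to the pointwise order, satisfies V(0) = 0, and is sub-additive: V(A ⊔ A') ≤ V(A) + V(A') for all A, A', where (A ⊔ A')(i) = max(A(i), A'(i)). Let n' : Fin m → ℕ, c : Fin m → ℝ with c(i) > 0 for all i, and B > 0, v > 0 reals. Let S : Fin m → ℕ with S(i) ≤ n'(i) for all i be such that for every A with A(i) ≤ n'(i) for all i, V(A) − (v/(2B))·∑_i A(i)·c(i) ≤ V(S) − (v/(2B))·∑_i S(i)·c(i), and suppose there exists Â with Â(i) ≤ n'(i) for all i, ∑_i Â(i)·c(i) ≤ B, and V(Â) ≥ v. Assume moreover S(i)·c(i) ≤ B for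 every i and ∑_i S(i)·c(i) > B. Let σ be a permutation of Fin m such that ℓ ↦ S(σ(ℓ))·c(σ(ℓ)) is monotone nonincreasing, let k be the largest number in {0,…,m} with ∑_{ℓ < k} S(σ(ℓ))·c(σ(ℓ)) ≤ B, and let S_v : Fin m → ℕ be defined by S_v(σ(ℓ)) = S(σ(ℓ)) for ℓ < k and S_v(i) = 0 for all other i. Then V(S_v) ≥ v/4. -/
/-- Core of Lemma B.1 (approximation guarantee of algorithm `A_Max`): when
the demand-oracle solution `S` (at prices `(v/(2B))·c`) is over budget, the
longest prefix `S_v` of players ordered by `S i * c i` decreasingly that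
fits in the budget retains value at least `v/4`. -/
theorem stmt_10 (m : ℕ) (hm : 1 ≤ m) (V : (Fin m → ℕ) → ℝ)
    (hmono : ∀ A A' : Fin m → ℕ, (∀ i, A i ≤ A' i) → V A ≤ V A')
    (hzero : V (fun _ => 0) = 0)
    (hsub : ∀ A A' : Fin m → ℕ,
      V (fun i => max (A i) (A' i)) ≤ V A + V A')
    (n' : Fin m → ℕ) (c : Fin m → ℝ) (hc : ∀ i, 0 < c i)
    (B v : ℝ) (hB : 0 < B) (hv : 0 < v)
    (S : Fin m → ℕ) (hSn : ∀ i, S i ≤ n' i)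
    (hSopt : ∀ A : Fin m → ℕ, (∀ i, A i ≤ n' i) →
      V A - (v / (2 * B)) * ∑ i, (A i : ℝ) * c i ≤
        V S - (v / (2 * B)) * ∑ i, (S i : ℝ) * c i)
    (Ahat : Fin m → ℕ) (hAn : ∀ i, Ahat i ≤ n' i)
    (hAB : ∑ i, (Ahat i : ℝ) * c i ≤ B) (hAv : V Ahat ≥ v)
    (hSiB : ∀ i, (S i : ℝ) * c i ≤ B)
    (hSover : ∑ i, (S i : ℝ) * c i > B)
    (σ : Equiv.Perm (Fin m))
    (hσ : Antitone (fun ℓ : Fin m => (S (σ ℓ) : ℝ) * c (σ ℓ)))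
    (k : ℕ) (hkm : k ≤ m)
    (hfit : ∑ ℓ ∈ Finset.univ.filter (fun ℓ : Fin m => (ℓ : ℕ) < k),
      (S (σ ℓ) : ℝ) * c (σ ℓ) ≤ B)
    (hmax : ∀ j ≤ m,
      (∑ ℓ ∈ Finset.univ.filter (fun ℓ : Fin m => (ℓ : ℕ) < j),
        (S (σ ℓ) : ℝ) * c (σ ℓ) ≤ B) → j ≤ k)
    (Sv : Fin m → ℕ)
    (hSv : ∀ i, Sv i = if ((σ.symm i : Fin m) : ℕ) < k then S i else 0) :
    V Sv ≥ v / 4 := by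
  have hcost : ∑ i, (Sv i : ℝ) * c i =
      ∑ ℓ ∈ Finset.univ.filter (fun ℓ : Fin m => (ℓ : ℕ) < k),
        (S (σ ℓ) : ℝ) * c (σ ℓ) := by
    rw [← Equiv.sum_comp σ, Finset.sum_filter]
    refine Finset.sum_congr rfl fun ℓ _ => ?_
    rw [hSv]
    simp only [Equiv.symm_apply_apply]
    split_ifs <;> simp
  have hnn : ∀ ℓ : Fin m, 0 ≤ (S (σ ℓ) : ℝ) * c (σ ℓ) := fun ℓ =>
    mul_nonneg (Nat.cast_nonneg _) (hc _).le
  have hk1 : 1 ≤ k := by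
    apply hmax 1 hm
    have : Finset.univ.filter (fun ℓ : Fin m => (ℓ : ℕ) < 1) = {⟨0, hm⟩} := by
      ext ℓ
      simp [Fin.ext_iff]
    rw [this, Finset.sum_singleton]
    exact hSiB _
  have hkm' : k < m := by
    rcases hkm.lt_or_eq with h | h
    · exact h
    · exfalso
      subst h
      have : Finset.univ.filter (fun ℓ : Fin k => (ℓ : ℕ) < k) = Finset.univ := by
        ext ℓ
        simp
      rw [this, Equiv.sum_comp σ (fun i => (S i : ℝ) * c i)] at hfit
      linarith
  have hnext : B < ∑ ℓ ∈ Finset.univ.filter (fun ℓ : Fin m => (ℓ : ℕ) < k + 1),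
        (S (σ ℓ) : ℝ) * c (σ ℓ) := by
    by_contra h
    have := hmax (k + 1) hkm' (not_lt.mp h)
    omega
  have hins : Finset.univ.filter (fun ℓ : Fin m => (ℓ : ℕ) < k + 1) =
      insert ⟨k, hkm'⟩ (Finset.univ.filter (fun ℓ : Fin m => (ℓ : ℕ) < k)) := by
    ext ℓ
    simp [Fin.ext_iff]
    omega
  rw [hins, Finset.sum_insert (by simp), ← hcost] at hnext
  have h0 : (S (σ ⟨k, hkm'⟩) : ℝ) * c (σ ⟨k, hkm'⟩) ≤ ∑ i, (Sv i : ℝ) * c i := by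
    rw [hcost]
    refine le_trans (hσ (show (⟨0, hm⟩ : Fin m) ≤ ⟨k, hkm'⟩ from Nat.zero_le k)) ?_
    exact Finset.single_le_sum (f := fun ℓ : Fin m => (S (σ ℓ) : ℝ) * c (σ ℓ))
      (fun ℓ _ => hnn ℓ) (by simp; omega)
  have hhalf : B / 2 ≤ ∑ i, (Sv i : ℝ) * c i := by linarith
  have hle : ∀ i, Sv i ≤ S i := by
    intro i
    rw [hSv]
    split_ifs <;> simp
  have hT := hSopt (fun i => S i - Sv i) (fun i => (Nat.sub_le _ _).trans (hSn i))
  have hTc : ∑ i, ((S i - Sv i : ℕ) : ℝ) * c i =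
      ∑ i, (S i : ℝ) * c i - ∑ i, (Sv i : ℝ) * c i := by
    rw [← Finset.sum_sub_distrib]
    refine Finset.sum_congr rfl fun i _ => ?_
    rw [Nat.cast_sub (hle i)]
    ring
  rw [hTc] at hT
  have hs := hsub Sv (fun i => S i - Sv i)
  have hmx : (fun i => max (Sv i) (S i - Sv i)) = S := by
    funext i
    rw [hSv]
    split_ifs <;> simp
  rw [hmx] at hs
  have hp : 0 < v / (2 * B) := by positivity
  have h1 := mul_le_mul_of_nonneg_left hhalf hp.le
  have h2 : v / (2 * B) * (B / 2) = v / 4 := by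
    field_simp
    norm_num
  rw [h2] at h1
  rw [mul_sub] at hT
  linarith
end

section
/- Let m ≥ 1 be a natural number and V : (Fin m → ℕ) → ℝ a function that is monotone with respect to the pointwise order, satisfies V(0) = 0, and is sub-additive: V(A ⊔ A') ≤ V(A) + V(A') for all A, A', where (A ⊔ A')(i) = max(A(i), A'(i)). Let A : Fin m → ℕ, and for a set C ⊆ Fin m let A_C denote the projection given by A_C(i) = A(i) for i ∈ C and A_C(i) = 0 otherwise. Suppose that for every i ∈ Fin m, V(A_{{i}}) < V(A)/2. Then there exists a set C ⊆ Fin m such that V(A_C) ≥ V(A)/4 and V(A_{Cᶜ}) ≥ V(A)/4, where Cᶜ is the complement of C. -/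
/-- Partition claim in the proof of Lemma B.2: for a monotone, sub-additive
valuation `V` with `V 0 = 0`, if no single seller's projection of `A`
carries half of `V A`, then the sellers split into a set `C` and its
complement whose projections each carry at least a quarter of `V A`. -/
theorem stmt_11 (m : ℕ) (hm : 1 ≤ m) (V : (Fin m → ℕ) → ℝ)
    (hmono : ∀ A A' : Fin m → ℕ, (∀ i, A i ≤ A' i) → V A ≤ V A')
    (hzero : V (fun _ => 0) = 0)
    (hsub : ∀ A A' : Fin m → ℕ,
      V (fun i => max (A i) (A' i)) ≤ V A + V A')
    (A : Fin m → ℕ)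
    (hsingle : ∀ i : Fin m,
      V (fun j => if j = i then A j else 0) < V A / 2) :
    ∃ C : Finset (Fin m),
      V (fun j => if j ∈ C then A j else 0) ≥ V A / 4 ∧
      V (fun j => if j ∈ Cᶜ then A j else 0) ≥ V A / 4 := by
  by_contra! hno
  have hpos : 0 < V A := by
    have h1 := hsingle ⟨0, hm⟩
    have h2 := hmono (fun _ => 0) (fun j => if j = ⟨0, hm⟩ then A j else 0)
      (fun i => Nat.zero_le _)
    linarith
  have hall : ∀ C : Finset (Fin m), V (fun j => if j ∈ C then A j else 0) < V A / 4 := by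
    intro C
    induction C using Finset.induction_on with
    | empty =>
      simp only [Finset.notMem_empty, if_false, hzero]
      linarith
    | insert a S ha ih =>
      by_contra! hge
      have hc := hno (insert a S) hge
      have h1 := hsub (fun j => if j = a then A j else 0) (fun j => if j ∈ S then A j else 0)
      have h2 := hmono (fun j => if j ∈ insert a S then A j else 0)
        (fun i => max (if i = a then A i else 0) (if i ∈ S then A i else 0)) (by
          intro i
          by_cases h : i = a <;> by_cases h' : i ∈ S <;> simp [h, h'])
      have h3 := hsub (fun j => if j ∈ insert a S then A j else 0)
        (fun j => if j ∈ (insert a S)ᶜ then A j else 0)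
      have h4 := hmono A (fun i => max (if i ∈ insert a S then A i else 0)
        (if i ∈ (insert a S)ᶜ then A i else 0)) (by
          intro i
          simp only [Finset.mem_compl]
          by_cases h : i ∈ insert a S
          · rw [if_pos h]; exact le_max_left _ _
          · rw [if_pos h]; exact le_max_right _ _)
      have h5 := hsingle a
      linarith
  have h := hall Finset.univ
  simp only [Finset.mem_univ, if_true] at h
  linarith
end

section
/- Let m ≥ 1 be a natural number and V : (Fin m → ℕ) → ℝ a function that is monotone with respect to the pointwise order, satisfies V(0) = 0, and is sub-additive: V(A ⊔ A') ≤ V(A) + V(A') for all A, A', where (A ⊔ A')(i) = max(A(i), A'(i)). Let c : Fin m → ℝ with c(i) > 0 for all i, n : Fin m → ℕ, and B > 0. Call A : Fin m → ℕ feasible if A(i) ≤ n(i) for all i and ∑_i A(i)·c(i) ≤ B, and say A is supported on a set S ⊆ Fin m if A(i) = 0 for all i ∉ S. Let OPT be the maximum of V over all feasible allocations, and for S ⊆ Fin m let opt(S) be the maximum of V over all feasible allocations supported on S. Suppose that for every i, V(E_i) < OPT/2, where E_i is the allocation with E_i(i) = min(n(i), ⌊B/c(i)⌋) and E_i(j)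 = 0 for j ≠ i. If T is a uniformly random subset of Fin m (each of the 2^m subsets having probability 2^{−m}), then the probability that both opt(Fin m \ T) ≥ opt(T) and opt(T) ≥ OPT/8 is at least 1/4. -/
/-- The optimal value of a budget-feasible allocation supported on the
seller set `S`: the supremum of `V A` over allocations `A` with
`A i ≤ n i`, total cost at most `B`, and `A i = 0` outside `S`. -/
noncomputable def optOn (m : ℕ) (V : (Fin m → ℕ) → ℝ) (n : Fin m → ℕ)
    (c : Fin m → ℝ) (B : ℝ) (S : Finset (Fin m)) : ℝ :=
  sSup {x : ℝ | ∃ A : Fin m → ℕ, (∀ i, A i ≤ n i) ∧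
    (∑ i, (A i : ℝ) * c i ≤ B) ∧ (∀ i ∉ S, A i = 0) ∧ V A = x}

open Classical

lemma half_count {α : Type*} [Fintype α] (f : α → α) (hf : Function.Injective f)
    (P Q : α → Prop) [DecidablePred P] [DecidablePred Q] (h : ∀ x, P x → Q x ∨ (Q (f x))) :
    (Finset.univ.filter P).card ≤ 2 * (Finset.univ.filter Q).card := by
  have h1 : Finset.univ.filter P ⊆
      Finset.univ.filter Q ∪ Finset.univ.filter (fun x => Q (f x)) := by
    intro x hx
    simp only [Finset.mem_union, Finset.mem_filter, Finset.mem_univ, true_and] at hx ⊢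
    exact h x hx
  have h2 : (Finset.univ.filter (fun x => Q (f x))).card ≤ (Finset.univ.filter Q).card := by
    apply Finset.card_le_card_of_injOn f
    · intro x hx
      simpa using hx
    · exact hf.injOn
  have h3 := Finset.card_le_card h1
  have h4 := Finset.card_union_le (Finset.univ.filter Q) (Finset.univ.filter (fun x => Q (f x)))
  omega

/-- Lemma B.2 (random-sampling step of `M_Rand`): if no single-seller
budget-feasible allocation `E_i` has value at least half the optimum `OPT`,
then for a uniformly random set `T` of sellers, with probability at least
`1/4` the optimum on the complement of `T` is at least the optimum on `T`,
which is at least `OPT / 8`. -/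
theorem stmt_12 (m : ℕ) (hm : 1 ≤ m) (V : (Fin m → ℕ) → ℝ)
    (hmono : ∀ A A' : Fin m → ℕ, (∀ i, A i ≤ A' i) → V A ≤ V A')
    (hzero : V (fun _ => 0) = 0)
    (hsub : ∀ A A' : Fin m → ℕ,
      V (fun i => max (A i) (A' i)) ≤ V A + V A')
    (c : Fin m → ℝ) (hc : ∀ i, 0 < c i) (n : Fin m → ℕ) (B : ℝ) (hB : 0 < B)
    (OPT : ℝ) (hOPT : OPT = optOn m V n c B Finset.univ)
    (E : Fin m → Fin m → ℕ)
    (hE : ∀ i j, E i j = if j = i then min (n i) ⌊B / c i⌋₊ else 0)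
    (hsingle : ∀ i, V (E i) < OPT / 2) :
    ((Finset.univ.filter (fun T : Finset (Fin m) =>
        optOn m V n c B Tᶜ ≥ optOn m V n c B T ∧
        optOn m V n c B T ≥ OPT / 8)).card : ℝ) / 2 ^ m ≥ 1 / 4 := by
  have hfin : ∀ S : Finset (Fin m), {x : ℝ | ∃ A : Fin m → ℕ, (∀ i, A i ≤ n i) ∧
    (∑ i, (A i : ℝ) * c i ≤ B) ∧ (∀ i ∉ S, A i = 0) ∧ V A = x}.Finite := by
    intro S
    apply ((Set.finite_Iic n).image V).subset
    rintro x ⟨A, h1, -, -, h4⟩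
    exact ⟨A, h1, h4⟩
  obtain ⟨A, hAn, hAB, -, hAV⟩ : OPT ∈ {x : ℝ | ∃ A : Fin m → ℕ, (∀ i, A i ≤ n i) ∧
    (∑ i, (A i : ℝ) * c i ≤ B) ∧ (∀ i ∉ (Finset.univ : Finset (Fin m)), A i = 0) ∧ V A = x} := by
    rw [hOPT]
    refine Set.Nonempty.csSup_mem ⟨0, fun _ => 0, by simp, by simpa using hB.le, by simp, hzero⟩
      (hfin _)
  have hpos : 0 < OPT := by
    have h1 := hsingle ⟨0, hm⟩
    have h2 := hmono (fun _ => 0) (E ⟨0, hm⟩) (fun _ => Nat.zero_le _)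
    linarith
  obtain ⟨W, hW⟩ : ∃ W : Finset (Fin m) → ℝ, ∀ S, W S = V (fun i => if i ∈ S then A i else 0) :=
    ⟨_, fun _ => rfl⟩
  have hWmono : ∀ S S', S ⊆ S' → W S ≤ W S' := by
    intro S S' h
    rw [hW, hW]
    apply hmono
    intro i
    by_cases hi : i ∈ S
    · simp [hi, h hi]
    · simp [hi]
  have hWsub : ∀ S S' U, U ⊆ S ∪ S' → W U ≤ W S + W S' := by
    intro S S' U h
    rw [hW, hW, hW]
    refine le_trans (hmono _ _ ?_) (hsub _ _)
    intro i
    by_cases hi : i ∈ U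
    · rcases Finset.mem_union.1 (h hi) with h' | h' <;> simp [hi, h']
    · simp [hi]
  have hWuniv : W Finset.univ = OPT := by rw [hW, ← hAV]; simp
  have hWempty : W ∅ = 0 := by rw [hW]; simpa using hzero
  have hWopt : ∀ S S', S ⊆ S' → W S ≤ optOn m V n c B S' := by
    intro S S' h
    refine le_trans (hWmono S S' h) ?_
    apply le_csSup (hfin S').bddAbove
    refine ⟨_, ?_, ?_, ?_, (hW S').symm⟩
    · intro i
      split_ifs
      · exact hAn i
      · exact Nat.zero_le _
    · refine le_trans (Finset.sum_le_sum ?_) hAB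
      intro i _
      apply mul_le_mul_of_nonneg_right _ (hc i).le
      split_ifs <;> simp
    · intro i hi
      simp [hi]
  have hWsing : ∀ i, W {i} < OPT / 2 := by
    intro i
    refine lt_of_le_of_lt ?_ (hsingle i)
    rw [hW]
    apply hmono
    intro j
    rw [hE]
    by_cases hj : j = i
    · subst hj
      simp only [Finset.mem_singleton, if_true]
      refine le_min (hAn j) (Nat.le_floor ?_)
      rw [le_div_iff₀ (hc j)]
      refine le_trans ?_ hAB
      exact Finset.single_le_sum (f := fun i => (A i : ℝ) * c i)
        (fun i _ => mul_nonneg (Nat.cast_nonneg _) (hc i).le) (Finset.mem_univ j)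
    · simp [hj]
  obtain ⟨S, hS, hS'⟩ : ∃ S, OPT / 4 ≤ W S ∧ OPT / 4 ≤ W Sᶜ := by
    obtain ⟨S, hS, hmin⟩ := WellFounded.has_min (wellFounded_lt (α := Finset (Fin m)))
      {S | OPT / 4 ≤ W S} ⟨Finset.univ, by simp only [Set.mem_ofPred_eq]; linarith⟩
    simp only [Set.mem_ofPred_eq] at hS hmin
    refine ⟨S, hS, ?_⟩
    have hne : S.Nonempty := by
      rw [Finset.nonempty_iff_ne_empty]
      rintro rfl
      linarith
    obtain ⟨a, ha⟩ := hne
    have h1 : W (S.erase a) < OPT / 4 := by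
      by_contra h
      exact hmin _ (not_lt.1 h) (Finset.erase_ssubset ha)
    have h2 := hWsub (S.erase a) {a} S (by
      intro x hx; by_cases h : x = a <;> simp [h, hx])
    have h3 := hWsub S Sᶜ Finset.univ (by simp)
    have h4 := hWsing a
    linarith
  have hpart : ∀ S T, OPT / 4 ≤ W S → OPT / 8 ≤ W (T ∩ S) ∨ OPT / 8 ≤ W (Tᶜ ∩ S) := by
    intro S T h
    have := hWsub (T ∩ S) (Tᶜ ∩ S) S (by
      intro x hx; by_cases h : x ∈ T <;> simp [h, hx])
    by_contra! hh
    linarith [hh.1, hh.2]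
  have key1 := half_count (fun T : Finset (Fin m) => symmDiff T S)
    (symmDiff_left_injective S) (fun _ => True)
    (fun T => OPT / 8 ≤ optOn m V n c B T ∧ OPT / 8 ≤ optOn m V n c B Tᶜ) (by
      intro T _
      rcases hpart S T hS with h1 | h1 <;> rcases hpart Sᶜ T hS' with h2 | h2
      · right
        exact ⟨h2.trans (hWopt _ _ (by
            intro x; simp only [Finset.mem_inter, Finset.mem_compl, Finset.mem_symmDiff]; tauto)),
          h1.trans (hWopt _ _ (by
            intro x; simp only [Finset.mem_inter, Finset.mem_compl, Finset.mem_symmDiff]; tauto))⟩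
      · left
        exact ⟨h1.trans (hWopt _ _ Finset.inter_subset_left),
          h2.trans (hWopt _ _ Finset.inter_subset_left)⟩
      · left
        exact ⟨h2.trans (hWopt _ _ Finset.inter_subset_left),
          h1.trans (hWopt _ _ Finset.inter_subset_left)⟩
      · right
        exact ⟨h1.trans (hWopt _ _ (by
            intro x; simp only [Finset.mem_inter, Finset.mem_compl, Finset.mem_symmDiff]; tauto)),
          h2.trans (hWopt _ _ (by
            intro x; simp only [Finset.mem_inter, Finset.mem_compl, Finset.mem_symmDiff]; tauto))⟩)
  have key2 := half_count (fun T : Finset (Fin m) => Tᶜ) compl_injective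
    (fun T => OPT / 8 ≤ optOn m V n c B T ∧ OPT / 8 ≤ optOn m V n c B Tᶜ)
    (fun T => optOn m V n c B Tᶜ ≥ optOn m V n c B T ∧ optOn m V n c B T ≥ OPT / 8) (by
      rintro T ⟨h1, h2⟩
      rcases le_total (optOn m V n c B T) (optOn m V n c B Tᶜ) with h | h
      · exact Or.inl ⟨h, h1⟩
      · right
        refine ⟨?_, h2⟩
        rw [compl_compl]
        exact h)
  have hcard : (Finset.univ.filter (fun _ : Finset (Fin m) => True)).card = 2 ^ m := by
    simp
  rw [hcard] at key1
  have key3 := key1.trans (Nat.mul_le_mul_left 2 key2)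
  rw [ge_iff_le, le_div_iff₀ (by positivity)]
  have key4 : ((2 ^ m : ℕ) : ℝ) ≤ _ := Nat.cast_le.2 key3
  push_cast at key4
  linarith
end
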